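/- arXiv:2107.08901 — 5 statements merged into one kernel-verified Lean document; each statement's English description precedes it below -/
import Mathlib

section
/- Two-sided approximate intertwining theorem: Let (S_i, σ_{i,i+1}) and (T_i, τ_{i,i+1}) be inductive sequences of Cu-semigroups with inductive limits (S, (σ_{i∞})) and (T, (τ_{i∞})) in Cu (in the sense of (L1),(L2)), and suppose each S_i carries a uniform basis (M_n^{S_i}, ε_n^{S_i})_n and each T_i a uniform basis (M_n^{T_i}, ε_n^{T_i})_n. Suppose there are Cu-morphisms c_i : S_i → T_i and d_i : T_i → S_{i+1} for every i, and strictly increasing sequences (n_i), (m_i) of natural numbers such that: (i) for all i ≤ j, σ_{ij}(M_{n_j}^{S_i}) ⊆ M_{n_j}^{S_j} and τ_{ij}(M_{m_j}^{T_i}) ⊆ M_{m_j}^{T_j}; (ii) d_i ∘ c_i ≈_{M_{n_i}^{S_i}} σ_{i,i+1} and c_{i+1} ∘ d_i ≈_{M_{m_i}^{T_i}} τ_{i,i+1} for every i; (iii) c_i(M_{n_i}^{S_i}) ⊆ M_{m_i}^{T_i} and d_i(M_{m_i}^{T_i}) ⊆ M_{n_{i+1}}^{S_{i+1}} for every i.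 Then there is an additive order-isomorphism S ≅ T; in particular S and T are isomorphic as Cu-semigroups. -/
open Set

/-- `x` is way-below `y`. -/
def WayBelow {S : Type*} [Preorder S] (x y : S) : Prop :=
  ∀ z : ℕ → S, Monotone z → ∀ w : S, IsLUB (Set.range z) w → y ≤ w → ∃ k, x ≤ z k

/-- The set `S_≪` of elements way-below something. -/
def wbSet (S : Type*) [Preorder S] : Set S := {s | ∃ t, WayBelow s t}

/-- `S` is an abstract Cuntz semigroup. -/
structure IsCu (S : Type*) [AddCommMonoid S] [PartialOrder S] [IsOrderedAddMonoid S] : Prop where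
  zero_le : ∀ x : S, 0 ≤ x
  O1 : ∀ z : ℕ → S, Monotone z → ∃ w, IsLUB (Set.range z) w
  O2 : ∀ x : S, ∃ z : ℕ → S, (∀ n, WayBelow (z n) (z (n + 1))) ∧ IsLUB (Set.range z) x
  O3 : ∀ x' x y' y : S, WayBelow x' x → WayBelow y' y → WayBelow (x' + y') (x + y)
  O4 : ∀ x y : ℕ → S, Monotone x → Monotone y → ∀ a b : S, IsLUB (Set.range x) a →
    IsLUB (Set.range y) b → IsLUB (Set.range fun n => x n + y n) (a + b)

/-- Generalized Cu-morphism. -/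
structure IsGenCuMorphism {S T : Type*} [AddCommMonoid S] [PartialOrder S] [IsOrderedAddMonoid S]
    [AddCommMonoid T] [PartialOrder T] [IsOrderedAddMonoid T]
    (f : S → T) : Prop where
  map_zero : f 0 = 0
  map_add : ∀ x y, f (x + y) = f x + f y
  mono : Monotone f
  map_sup : ∀ (z : ℕ → S) (w : S), Monotone z → IsLUB (Set.range z) w →
    IsLUB (Set.range fun n => f (z n)) (f w)

/-- Cu-morphism. -/
structure IsCuMorphism {S T : Type*} [AddCommMonoid S] [PartialOrder S] [IsOrderedAddMonoid S]
    [AddCommMonoid T] [PartialOrder T] [IsOrderedAddMonoid T]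
    (f : S → T) extends IsGenCuMorphism f : Prop where
  map_wayBelow : ∀ x y, WayBelow x y → WayBelow (f x) (f y)

/-- A uniform basis of a Cu-semigroup. -/
structure UniformBasis (S : Type*) [AddCommMonoid S] [PartialOrder S] [IsOrderedAddMonoid S] where
  M : ℕ → Set S
  eps : ℕ → S → S
  M_zero : M 0 = {0}
  zero_mem : ∀ n, (0 : S) ∈ M n
  add_mem : ∀ n, ∀ x ∈ M n, ∀ y ∈ M n, x + y ∈ M n
  M_subset : ∀ n, M n ⊆ wbSet S
  eps_mem : ∀ n, ∀ s ∈ wbSet S, eps n s ∈ M n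
  eps_mono : ∀ n, ∀ s ∈ wbSet S, ∀ t ∈ wbSet S, s ≤ t → eps n s ≤ eps n t
  eps_superadd : ∀ n, ∀ s ∈ wbSet S, ∀ t ∈ wbSet S, eps n s + eps n t ≤ eps n (s + t)
  U1 : ∀ n, M n ⊆ M (n + 1)
  U2 : ∀ n s t, (∃ l, l + 1 < n ∧ s ∈ M l) → (∃ l, l + 1 < n ∧ t ∈ M l) →
    eps n (s + t) = eps n s + eps n t
  U3_mono : ∀ s ∈ wbSet S, ∀ n, eps n s ≤ eps (n + 1) s
  U3_wb : ∀ s ∈ wbSet S, ∀ n, WayBelow (eps n s) s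
  U3_sup : ∀ s ∈ wbSet S, IsLUB (Set.range fun n => eps n s) s
  U4 : ∀ l, ∀ s ∈ M l, ∀ n, l < n → WayBelow (eps n s) (eps (n + 1) s)

/-- Strict comparison `α ≈_Λ β` of two maps on a subset `Λ`. -/
def ApproxOn {S T : Type*} [Preorder S] [Preorder T] (α β : S → T) (Λ : Set S) : Prop :=
  ∀ g' ∈ Λ, ∀ g ∈ Λ, WayBelow g' g → WayBelow (α g') (β g) ∧ WayBelow (β g') (α g)

/-- Comparison `α ≃_Λ β` of two maps on a subset `Λ`. -/
def CompareOn {S T : Type*} [Preorder S] [Preorder T] (α β : S → T) (Λ : Set S) : Prop :=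
  ∀ g' ∈ Λ, ∀ g ∈ Λ, WayBelow g' g → α g' ≤ β g ∧ β g' ≤ α g


section Aux

theorem WayBelow.le' {S : Type*} [Preorder S] {x y : S} (h : WayBelow x y) : x ≤ y := by
  obtain ⟨k, hk⟩ := h (fun _ => y) monotone_const y (by simp [Set.range_const]) le_rfl
  exact hk

theorem WayBelow.trans_le' {S : Type*} [Preorder S] {x y z : S} (h : WayBelow x y) (h2 : y ≤ z) :
    WayBelow x z := fun u hu w hw hz => h u hu w hw (h2.trans hz)

theorem le_trans_wb {S : Type*} [Preorder S] {x y z : S} (h : x ≤ y) (h2 : WayBelow y z) :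
    WayBelow x z := fun u hu w hw hz => by
  obtain ⟨k, hk⟩ := h2 u hu w hw hz
  exact ⟨k, h.trans hk⟩

/-- A finite way-below chain of length `K + 1` in `A`. -/
def WBChain {S : Type*} [Preorder S] (K : ℕ) (A : Set S) (a : ℕ → S) : Prop :=
  (∀ r, r ≤ K → a r ∈ A) ∧ ∀ r, r < K → WayBelow (a r) (a (r + 1))

theorem WBChain.sub {S : Type*} [Preorder S] {K : ℕ} {A : Set S} {a : ℕ → S} (h : WBChain K A a)
    (p L : ℕ) (hL : p + L ≤ K) : WBChain L A (fun r => a (p + r)) :=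
  ⟨fun r hr => h.1 _ (by omega), fun r hr => h.2 _ (by omega)⟩

theorem WBChain.pre {S : Type*} [Preorder S] {K : ℕ} {A : Set S} {a : ℕ → S} (h : WBChain K A a)
    (L : ℕ) (hL : L ≤ K) : WBChain L A a :=
  ⟨fun r hr => h.1 _ (by omega), fun r hr => h.2 _ (by omega)⟩

/-- The comparison relation between the two limits. -/
def Nrel {S : ℕ → Type*} [∀ i, PartialOrder (S i)] {SL TL : Type*} [PartialOrder SL]
    [PartialOrder TL] (A : ∀ i, Set (S i)) (σinf : ∀ i, S i → SL) (φ : ∀ i, S i → TL)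
    (s : SL) (t : TL) : Prop :=
  ∃ K, ∀ i, K ≤ i → ∀ a : ℕ → S i, WBChain 4 (A i) a → σinf i (a 4) ≤ s → φ i (a 0) ≤ t

/-- The one-sided list of data. -/
structure Sys {S T : ℕ → Type*} [∀ i, AddCommMonoid (S i)] [∀ i, PartialOrder (S i)]
    [∀ i, IsOrderedAddMonoid (S i)]
    [∀ i, AddCommMonoid (T i)] [∀ i, PartialOrder (T i)]
    [∀ i, IsOrderedAddMonoid (T i)]
    {SL TL : Type*} [AddCommMonoid SL] [PartialOrder SL] [IsOrderedAddMonoid SL]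
    [AddCommMonoid TL] [PartialOrder TL] [IsOrderedAddMonoid TL]
    (σ : ∀ i j : ℕ, S i → S j) (τ : ∀ i j : ℕ, T i → T j)
    (σinf : ∀ i, S i → SL) (τinf : ∀ i, T i → TL)
    (c : ∀ i, S i → T i) (d : ∀ i, T i → S (i + 1))
    (A : ∀ i, Set (S i)) (B : ∀ i, Set (T i)) : Prop where
  hS : ∀ i, IsCu (S i)
  hSL : IsCu SL
  hTL : IsCu TL
  σid : ∀ i x, σ i i x = x
  τid : ∀ i x, τ i i x = x
  σcomp : ∀ i j k : ℕ, i ≤ j → j ≤ k → ∀ x, σ j k (σ i j x) = σ i k x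
  τcomp : ∀ i j k : ℕ, i ≤ j → j ≤ k → ∀ x, τ j k (τ i j x) = τ i k x
  σcu : ∀ i j : ℕ, i ≤ j → IsCuMorphism (σ i j)
  τcu : ∀ i j : ℕ, i ≤ j → IsCuMorphism (τ i j)
  σinfcu : ∀ i, IsCuMorphism (σinf i)
  τinfcu : ∀ i, IsCuMorphism (τinf i)
  σinfcomp : ∀ i j : ℕ, i ≤ j → ∀ x, σinf j (σ i j x) = σinf i x
  τinfcomp : ∀ i j : ℕ, i ≤ j → ∀ x, τinf j (τ i j x) = τinf i x
  L2S : ∀ (i : ℕ) (s t : S i), σinf i s ≤ σinf i t → ∀ s', WayBelow s' s →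
      ∃ j, i ≤ j ∧ WayBelow (σ i j s') (σ i j t)
  ccu : ∀ i, IsCuMorphism (c i)
  dcu : ∀ i, IsCuMorphism (d i)
  hA : ∀ i j, i ≤ j → ∀ x ∈ A i, σ i j x ∈ A j
  hB : ∀ i j, i ≤ j → ∀ x ∈ B i, τ i j x ∈ B j
  addA : ∀ i, ∀ x ∈ A i, ∀ y ∈ A i, x + y ∈ A i
  hdc : ∀ i, ApproxOn (fun x => d i (c i x)) (σ i (i + 1)) (A i)
  hcd : ∀ i, ApproxOn (fun x => c (i + 1) (d i x)) (τ i (i + 1)) (B i)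
  hcM : ∀ i, ∀ x ∈ A i, c i x ∈ B i
  hdM : ∀ i, ∀ x ∈ B i, d i x ∈ A (i + 1)
  dense : ∀ s w : SL, WayBelow w s → ∀ K, ∃ J, ∀ j, J ≤ j → ∃ a : ℕ → S j, WBChain K (A j) a ∧
    w ≤ σinf j (a 0) ∧ σinf j (a K) ≤ s

/-- Zigzag. -/
def zz {S T : ℕ → Type*} (c : ∀ i, S i → T i) (d : ∀ i, T i → S (i + 1)) (i : ℕ) (x : S i) :
    ∀ k, S (i + k)
  | 0 => x
  | k + 1 => d (i + k) (c (i + k) (zz c d i x k))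

section
variable {S T : ℕ → Type*} [∀ i, AddCommMonoid (S i)] [∀ i, PartialOrder (S i)]
    [∀ i, IsOrderedAddMonoid (S i)]
    [∀ i, AddCommMonoid (T i)] [∀ i, PartialOrder (T i)]
    [∀ i, IsOrderedAddMonoid (T i)]
    {SL TL : Type*} [AddCommMonoid SL] [PartialOrder SL] [IsOrderedAddMonoid SL]
    [AddCommMonoid TL] [PartialOrder TL] [IsOrderedAddMonoid TL]
    {σ : ∀ i j : ℕ, S i → S j} {τ : ∀ i j : ℕ, T i → T j}
    {σinf : ∀ i, S i → SL} {τinf : ∀ i, T i → TL}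
    {c : ∀ i, S i → T i} {d : ∀ i, T i → S (i + 1)}
    {A : ∀ i, Set (S i)} {B : ∀ i, Set (T i)}

theorem Sys.zz_mem (H : Sys σ τ σinf τinf c d A B) (i : ℕ) (x : S i) (hx : x ∈ A i) (k : ℕ) :
    zz c d i x k ∈ A (i + k) := by
  induction k with
  | zero => exact hx
  | succ k ih => exact H.hdM _ _ (H.hcM _ _ ih)

theorem Sys.zz_σ (H : Sys σ τ σinf τinf c d A B) (i : ℕ) (x y : S i) (hx : x ∈ A i)
    (hy : y ∈ A i) (h : WayBelow x y) (k : ℕ) :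
    WayBelow (zz c d i x k) (σ i (i + k) y) ∧ WayBelow (σ i (i + k) x) (zz c d i y k) := by
  induction k with
  | zero =>
    have e1 := H.σid i y
    have e2 := H.σid i x
    constructor
    · show WayBelow x (σ i i y)
      rw [e1]; exact h
    · show WayBelow (σ i i x) y
      rw [e2]; exact h
  | succ k ih =>
    have hs := fun z => H.σcomp i (i + k) (i + k + 1) (by omega) (by omega) z
    constructor
    · have := (H.hdc (i + k) _ (H.zz_mem i x hx k) _ (H.hA i (i + k) (by omega) y hy) ih.1).1
      rw [hs] at this
      exact this
    · have := (H.hdc (i + k) _ (H.hA i (i + k) (by omega) x hx) _ (H.zz_mem i y hy k) ih.2).2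
      rw [hs] at this
      exact this

theorem Sys.zz_τ (H : Sys σ τ σinf τinf c d A B) (i : ℕ) (x y : S i) (hx : x ∈ A i)
    (hy : y ∈ A i) (h : WayBelow x y) (k : ℕ) :
    WayBelow (c (i + k) (zz c d i x k)) (τ i (i + k) (c i y)) ∧
    WayBelow (τ i (i + k) (c i x)) (c (i + k) (zz c d i y k)) := by
  induction k with
  | zero =>
    have e1 := H.τid i (c i y)
    have e2 := H.τid i (c i x)
    have h' := (H.ccu i).map_wayBelow _ _ h
    constructor
    · show WayBelow (c i x) (τ i i (c i y))
      rw [e1]; exact h'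
    · show WayBelow (τ i i (c i x)) (c i y)
      rw [e2]; exact h'
  | succ k ih =>
    have hs := fun z => H.τcomp i (i + k) (i + k + 1) (by omega) (by omega) z
    constructor
    · have := (H.hcd (i + k) _ (H.hcM _ _ (H.zz_mem i x hx k)) _
        (H.hB i (i + k) (by omega) _ (H.hcM _ y hy)) ih.1).1
      rw [hs] at this
      exact this
    · have := (H.hcd (i + k) _ (H.hB i (i + k) (by omega) _ (H.hcM _ x hx)) _
        (H.hcM _ _ (H.zz_mem i y hy k)) ih.2).2
      rw [hs] at this
      exact this

theorem Sys.fact3 (H : Sys σ τ σinf τinf c d A B) (i j : ℕ) (hij : i ≤ j) (x y z : S i)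
    (hx : x ∈ A i) (hy : y ∈ A i) (hz : z ∈ A i) (h : WayBelow x y) (h' : WayBelow y z) :
    τ i j (c i x) ≤ c j (σ i j z) ∧ c j (σ i j x) ≤ τ i j (c i z) := by
  obtain ⟨k, rfl⟩ := Nat.exists_eq_add_of_le hij
  exact ⟨(H.zz_τ i x y hx hy h k).2.le'.trans ((H.ccu _).mono (H.zz_σ i y z hy hz h' k).1.le'),
    ((H.ccu _).mono (H.zz_σ i x y hx hy h k).2.le').trans (H.zz_τ i y z hy hz h' k).1.le'⟩

theorem Sys.fact4 (H : Sys σ τ σinf τinf c d A B) (i j : ℕ) (a : ℕ → S i) (b : ℕ → S j)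
    (ha : WBChain 3 (A i) a) (hb : WBChain 2 (A j) b) (h : σinf i (a 3) ≤ σinf j (b 0)) :
    τinf i (c i (a 0)) ≤ τinf j (c j (b 2)) := by
  set m := max i j with hm
  have him : i ≤ m := le_max_left _ _
  have hjm : j ≤ m := le_max_right _ _
  obtain ⟨k, hmk, hk⟩ := H.L2S m (σ i m (a 3)) (σ j m (b 0))
    (by rw [H.σinfcomp _ _ him, H.σinfcomp _ _ hjm]; exact h) (σ i m (a 2))
    ((H.σcu _ _ him).map_wayBelow _ _ (ha.2 2 (by omega)))
  rw [H.σcomp _ _ _ him hmk, H.σcomp _ _ _ hjm hmk] at hk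
  rw [← H.τinfcomp i k (him.trans hmk), ← H.τinfcomp j k (hjm.trans hmk)]
  apply (H.τinfcu k).mono
  refine (H.fact3 i k (him.trans hmk) (a 0) (a 1) (a 2) (ha.1 _ (by omega)) (ha.1 _ (by omega))
    (ha.1 _ (by omega)) (ha.2 _ (by omega)) (ha.2 _ (by omega))).1.trans ?_
  refine ((H.ccu k).mono hk.le').trans ?_
  exact (H.fact3 j k (hjm.trans hmk) (b 0) (b 1) (b 2) (hb.1 _ (by omega)) (hb.1 _ (by omega))
    (hb.1 _ (by omega)) (hb.2 _ (by omega)) (hb.2 _ (by omega))).2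

theorem Sys.round (H : Sys σ τ σinf τinf c d A B) (i : ℕ) (x y : S i) (hx : x ∈ A i)
    (hy : y ∈ A i) (h : WayBelow x y) :
    σinf (i + 1) (d i (c i x)) ≤ σinf i y ∧ σinf i x ≤ σinf (i + 1) (d i (c i y)) := by
  have := H.hdc i x hx y hy h
  rw [← H.σinfcomp i (i + 1) (by omega) x, ← H.σinfcomp i (i + 1) (by omega) y]
  exact ⟨(H.σinfcu _).mono this.1.le', (H.σinfcu _).mono this.2.le'⟩

theorem Sys.mapChain (H : Sys σ τ σinf τinf c d A B) {K i : ℕ} {a : ℕ → S i}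
    (h : WBChain K (A i) a) : WBChain K (B i) (fun r => c i (a r)) :=
  ⟨fun r hr => H.hcM _ _ (h.1 r hr), fun r hr => (H.ccu i).map_wayBelow _ _ (h.2 r hr)⟩

theorem le_of_wb {S : Type*} [AddCommMonoid S] [PartialOrder S] [IsOrderedAddMonoid S]
    (h : IsCu S) (s s' : S) (hw : ∀ w, WayBelow w s → w ≤ s') : s ≤ s' := by
  obtain ⟨z, hz, hs⟩ := h.O2 s
  apply hs.2
  rintro _ ⟨n, rfl⟩
  exact hw _ ((hz n).trans_le' (hs.1 ⟨n + 1, rfl⟩))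

theorem Sys.comp (H : Sys σ τ σinf τinf c d A B) {s s' : SL} {t : TL}
    (h1 : Nrel A σinf (fun i x => τinf i (c i x)) s t)
    (h2 : Nrel B τinf (fun i y => σinf (i + 1) (d i y)) t s') : s ≤ s' := by
  obtain ⟨K1, h1⟩ := h1
  obtain ⟨K2, h2⟩ := h2
  apply le_of_wb H.hSL
  intro w hw
  obtain ⟨J, hJ⟩ := H.dense s w hw 9
  obtain ⟨a, ha, hwa, has⟩ := hJ (J + K1 + K2) (by omega)
  have e1 := h1 _ (by omega) _ (ha.sub 5 4 (by omega)) has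
  have e2 := h2 _ (by omega) _ (H.mapChain (ha.sub 1 4 (by omega))) e1
  exact hwa.trans ((H.round _ (a 0) (a 1) (ha.1 _ (by omega)) (ha.1 _ (by omega))
    (ha.2 _ (by omega))).2.trans e2)

theorem Sys.add (H : Sys σ τ σinf τinf c d A B) {s1 s2 : SL} {t1 t2 : TL}
    (h1 : Nrel A σinf (fun i x => τinf i (c i x)) s1 t1)
    (h2 : Nrel A σinf (fun i x => τinf i (c i x)) s2 t2) :
    Nrel A σinf (fun i x => τinf i (c i x)) (s1 + s2) (t1 + t2) := by
  obtain ⟨K1, h1⟩ := h1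
  obtain ⟨K2, h2⟩ := h2
  refine ⟨0, fun i _ e he hes => ?_⟩
  have hwb : WayBelow (σinf i (e 3)) (s1 + s2) :=
    ((H.σinfcu i).map_wayBelow _ _ (he.2 3 (by omega))).trans_le' hes
  obtain ⟨z1, hz1, hs1⟩ := H.hSL.O2 s1
  obtain ⟨z2, hz2, hs2⟩ := H.hSL.O2 s2
  have m1 : Monotone z1 := monotone_nat_of_le_succ fun n => (hz1 n).le'
  have m2 : Monotone z2 := monotone_nat_of_le_succ fun n => (hz2 n).le'
  obtain ⟨n, hn⟩ := hwb _ (m1.add m2) _ (H.hSL.O4 z1 z2 m1 m2 _ _ hs1 hs2) le_rfl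
  obtain ⟨J1, hJ1⟩ := H.dense s1 (z1 n) ((hz1 n).trans_le' (hs1.1 ⟨n + 1, rfl⟩)) 6
  obtain ⟨J2, hJ2⟩ := H.dense s2 (z2 n) ((hz2 n).trans_le' (hs2.1 ⟨n + 1, rfl⟩)) 6
  obtain ⟨a, ha, hza, has⟩ := hJ1 (J1 + J2 + K1 + K2) (by omega)
  obtain ⟨b, hb, hzb, hbs⟩ := hJ2 (J1 + J2 + K1 + K2) (by omega)
  have key := H.fact4 i _ e (fun r => a r + b r) ⟨fun r hr => he.1 r (by omega),
      fun r hr => he.2 r (by omega)⟩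
    ⟨fun r hr => H.addA _ _ (ha.1 r (by omega)) _ (hb.1 r (by omega)),
      fun r hr => (H.hS _).O3 _ _ _ _ (ha.2 r (by omega)) (hb.2 r (by omega))⟩
    (by
      rw [(H.σinfcu _).map_add]
      exact hn.trans (add_le_add hza hzb))
  refine key.trans ?_
  rw [(H.ccu _).map_add, (H.τinfcu _).map_add]
  exact add_le_add (h1 _ (by omega) _ (ha.sub 2 4 (by omega)) has)
    (h2 _ (by omega) _ (hb.sub 2 4 (by omega)) hbs)

/-- Existence; `fact4T` is the mirror image of `Sys.fact4`. -/
theorem Sys.exist (H : Sys σ τ σinf τinf c d A B)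
    (fact4T : ∀ (i j : ℕ) (a : ℕ → T i) (b : ℕ → T j),
      WBChain 3 (B i) a → WBChain 2 (B j) b → τinf i (a 3) ≤ τinf j (b 0) →
      σinf (i + 1) (d i (a 0)) ≤ σinf (j + 1) (d j (b 2))) (s : SL) :
    ∃ t : TL, Nrel A σinf (fun i x => τinf i (c i x)) s t ∧
      Nrel B τinf (fun i y => σinf (i + 1) (d i y)) t s := by
  obtain ⟨w, hw, hs⟩ := H.hSL.O2 s
  have mw : Monotone w := monotone_nat_of_le_succ fun n => (hw n).le'
  have ex : ∀ n, ∃ j, ∃ a : ℕ → S j, WBChain 5 (A j) a ∧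
      w n ≤ σinf j (a 0) ∧ σinf j (a 5) ≤ w (n + 1) := fun n => by
    obtain ⟨J, hJ⟩ := H.dense _ _ (hw n) 5
    exact ⟨J, hJ J le_rfl⟩
  choose j a ha hwa haw using ex
  have mt : Monotone fun n => τinf (j n) (c (j n) (a n 2)) := by
    apply monotone_nat_of_le_succ
    intro n
    exact H.fact4 _ _ _ _ ((ha n).sub 2 3 (by omega)) ((ha (n + 1)).pre 2 (by omega))
      ((haw n).trans (hwa (n + 1)))
  obtain ⟨t, ht⟩ := H.hTL.O1 _ mt
  refine ⟨t, ⟨0, fun i _ e he hes => ?_⟩, ⟨0, fun i _ b hb hbt => ?_⟩⟩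
  · have hwb : WayBelow (σinf i (e 3)) s :=
      ((H.σinfcu i).map_wayBelow _ _ (he.2 3 (by omega))).trans_le' hes
    obtain ⟨n, hn⟩ := hwb _ mw _ hs le_rfl
    exact (H.fact4 i _ _ _ (he.pre 3 (by omega)) ((ha n).pre 2 (by omega))
      (hn.trans (hwa n))).trans (ht.1 ⟨n, rfl⟩)
  · have hwb : WayBelow (τinf i (b 3)) t :=
      ((H.τinfcu i).map_wayBelow _ _ (hb.2 3 (by omega))).trans_le' hbt
    obtain ⟨n, hn⟩ := hwb _ mt _ ht le_rfl
    refine (fact4T i _ _ _ (hb.pre 3 (by omega))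
      (H.mapChain ((ha n).sub 2 2 (by omega))) hn).trans ?_
    exact (H.round _ (a n 4) (a n 5) ((ha n).1 _ (by omega)) ((ha n).1 _ (by omega))
      ((ha n).2 _ (by omega))).1.trans ((haw n).trans (hs.1 ⟨n + 1, rfl⟩))

end

theorem UniformBasis.M_mono {S : Type*} [AddCommMonoid S] [PartialOrder S] [IsOrderedAddMonoid S]
    (U : UniformBasis S) : Monotone U.M := monotone_nat_of_le_succ U.U1

theorem dense_aux {S : ℕ → Type*} [∀ i, AddCommMonoid (S i)] [∀ i, PartialOrder (S i)]
    [∀ i, IsOrderedAddMonoid (S i)]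
    (σ : ∀ i j : ℕ, S i → S j)
    (hσcomp : ∀ i j k : ℕ, i ≤ j → j ≤ k → ∀ x, σ j k (σ i j x) = σ i k x)
    (hσcu : ∀ i j : ℕ, i ≤ j → IsCuMorphism (σ i j))
    {SL : Type*} [AddCommMonoid SL] [PartialOrder SL] [IsOrderedAddMonoid SL]
    (σinf : ∀ i, S i → SL)
    (hσinfcu : ∀ i, IsCuMorphism (σinf i))
    (hσinfcomp : ∀ i j : ℕ, i ≤ j → ∀ x, σinf j (σ i j x) = σinf i x)
    (hL1S : ∀ s : SL, ∃ sf : ∀ i, S i, (∀ i, WayBelow (σ i (i + 1) (sf i)) (sf (i + 1))) ∧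
      IsLUB (Set.range fun i => σinf i (sf i)) s)
    (US : ∀ i, UniformBasis (S i))
    (nseq : ℕ → ℕ) (hn : StrictMono nseq)
    (hMS : ∀ i j : ℕ, i ≤ j → ∀ x ∈ (US i).M (nseq j), σ i j x ∈ (US j).M (nseq j))
    (s w : SL) (hws : WayBelow w s) (K : ℕ) : ∃ J, ∀ j, J ≤ j → ∃ a : ℕ → S j,
      WBChain K ((US j).M (nseq j)) a ∧ w ≤ σinf j (a 0) ∧ σinf j (a K) ≤ s := by
  obtain ⟨sf, hsf, hs⟩ := hL1S s
  have mono : Monotone fun i => σinf i (sf i) := by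
    apply monotone_nat_of_le_succ
    intro i
    rw [← hσinfcomp i (i + 1) (by omega)]
    exact (hσinfcu _).mono (hsf i).le'
  obtain ⟨i, hi⟩ := hws _ mono _ hs le_rfl
  -- everything happens in `S p`
  obtain ⟨p, hp⟩ : ∃ p, p = i + 1 + 1 + 1 := ⟨_, rfl⟩
  have x01 : WayBelow (σ i p (sf i)) (σ (i + 1) p (sf (i + 1))) := by
    rw [← hσcomp i (i + 1) p (by omega) (by omega)]
    exact (hσcu _ _ (by omega)).map_wayBelow _ _ (hsf i)
  have x12 : WayBelow (σ (i + 1) p (sf (i + 1))) (σ (i + 1 + 1) p (sf (i + 1 + 1))) := by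
    rw [← hσcomp (i + 1) (i + 1 + 1) p (by omega) (by omega)]
    exact (hσcu _ _ (by omega)).map_wayBelow _ _ (hsf (i + 1))
  have x2 : σ (i + 1 + 1) p (sf (i + 1 + 1)) ∈ wbSet (S p) := by
    subst hp
    exact ⟨_, hsf (i + 1 + 1)⟩
  have x2s : σinf p (σ (i + 1 + 1) p (sf (i + 1 + 1))) ≤ s := by
    rw [hσinfcomp _ _ (by omega)]
    exact hs.1 ⟨i + 1 + 1, rfl⟩
  have x0w : w ≤ σinf p (σ i p (sf i)) := by
    rw [hσinfcomp _ _ (by omega)]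
    exact hi
  generalize σ i p (sf i) = u0 at *
  generalize σ (i + 1) p (sf (i + 1)) = u1 at *
  generalize σ (i + 1 + 1) p (sf (i + 1 + 1)) = u2 at *
  have me : ∀ u ∈ wbSet (S p), Monotone fun n => (US p).eps n u := fun u hu =>
    monotone_nat_of_le_succ ((US p).U3_mono u hu)
  obtain ⟨q, hq⟩ := x12 _ (me u2 x2) _ ((US p).U3_sup u2 x2) le_rfl
  have hg := (US p).eps_mem q u2 x2
  have hgs := (US p).U3_wb u2 x2 q
  generalize (US p).eps q u2 = g at *
  have hgw := (US p).M_subset _ hg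
  obtain ⟨n, hn'⟩ := (x01.trans_le' hq) _ (me g hgw) _ ((US p).U3_sup g hgw) le_rfl
  refine ⟨p + q + 1 + n + K, fun j hj => ⟨fun r => σ p j ((US p).eps (q + 1 + n + r) g), ⟨?_, ?_⟩,
    ?_, ?_⟩⟩
  · intro r hr
    apply hMS p j (by omega)
    have := hn.id_le j
    exact (US p).M_mono (by simp only [id] at this; omega) ((US p).eps_mem _ g hgw)
  · intro r hr
    exact (hσcu p j (by omega)).map_wayBelow _ _ ((US p).U4 q g hg _ (by omega))
  · rw [hσinfcomp _ _ (by omega)]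
    exact x0w.trans ((hσinfcu _).mono (hn'.trans (me g hgw (by omega))))
  · rw [hσinfcomp _ _ (by omega)]
    exact ((hσinfcu _).mono (((US p).U3_wb g hgw _).le'.trans hgs.le')).trans x2s

end Aux

/-- **Two-sided approximate intertwining theorem.** -/
theorem two_sided_approximate_intertwining
    {S T : ℕ → Type*} [∀ i, AddCommMonoid (S i)] [∀ i, PartialOrder (S i)]
    [∀ i, IsOrderedAddMonoid (S i)]
    [∀ i, AddCommMonoid (T i)] [∀ i, PartialOrder (T i)]
    [∀ i, IsOrderedAddMonoid (T i)]
    (hS : ∀ i, IsCu (S i)) (hT : ∀ i, IsCu (T i))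
    (σ : ∀ i j : ℕ, S i → S j) (τ : ∀ i j : ℕ, T i → T j)
    (hσid : ∀ i x, σ i i x = x) (hτid : ∀ i x, τ i i x = x)
    (hσcomp : ∀ i j k : ℕ, i ≤ j → j ≤ k → ∀ x, σ j k (σ i j x) = σ i k x)
    (hτcomp : ∀ i j k : ℕ, i ≤ j → j ≤ k → ∀ x, τ j k (τ i j x) = τ i k x)
    (hσcu : ∀ i j : ℕ, i ≤ j → IsCuMorphism (σ i j))
    (hτcu : ∀ i j : ℕ, i ≤ j → IsCuMorphism (τ i j))
    {SL TL : Type*} [AddCommMonoid SL] [PartialOrder SL] [IsOrderedAddMonoid SL]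
    [AddCommMonoid TL] [PartialOrder TL] [IsOrderedAddMonoid TL]
    (hSL : IsCu SL) (hTL : IsCu TL)
    (σinf : ∀ i, S i → SL) (τinf : ∀ i, T i → TL)
    (hσinfcu : ∀ i, IsCuMorphism (σinf i)) (hτinfcu : ∀ i, IsCuMorphism (τinf i))
    (hσinfcomp : ∀ i j : ℕ, i ≤ j → ∀ x, σinf j (σ i j x) = σinf i x)
    (hτinfcomp : ∀ i j : ℕ, i ≤ j → ∀ x, τinf j (τ i j x) = τinf i x)
    (hL1S : ∀ s : SL, ∃ sf : ∀ i, S i, (∀ i, WayBelow (σ i (i + 1) (sf i)) (sf (i + 1))) ∧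
      IsLUB (Set.range fun i => σinf i (sf i)) s)
    (hL1T : ∀ t : TL, ∃ tf : ∀ i, T i, (∀ i, WayBelow (τ i (i + 1) (tf i)) (tf (i + 1))) ∧
      IsLUB (Set.range fun i => τinf i (tf i)) t)
    (hL2S : ∀ (i : ℕ) (s t : S i), σinf i s ≤ σinf i t → ∀ s', WayBelow s' s →
      ∃ j, i ≤ j ∧ WayBelow (σ i j s') (σ i j t))
    (hL2T : ∀ (i : ℕ) (s t : T i), τinf i s ≤ τinf i t → ∀ s', WayBelow s' s →
      ∃ j, i ≤ j ∧ WayBelow (τ i j s') (τ i j t))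
    (US : ∀ i, UniformBasis (S i)) (UT : ∀ i, UniformBasis (T i))
    (c : ∀ i, S i → T i) (d : ∀ i, T i → S (i + 1))
    (hc : ∀ i, IsCuMorphism (c i)) (hd : ∀ i, IsCuMorphism (d i))
    (nseq mseq : ℕ → ℕ) (hn : StrictMono nseq) (hm : StrictMono mseq)
    -- (i)
    (hMS : ∀ i j : ℕ, i ≤ j → ∀ x ∈ (US i).M (nseq j), σ i j x ∈ (US j).M (nseq j))
    (hMT : ∀ i j : ℕ, i ≤ j → ∀ x ∈ (UT i).M (mseq j), τ i j x ∈ (UT j).M (mseq j))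
    -- (ii)
    (hdc : ∀ i, ApproxOn (fun x => d i (c i x)) (σ i (i + 1)) ((US i).M (nseq i)))
    (hcd : ∀ i, ApproxOn (fun x => c (i + 1) (d i x)) (τ i (i + 1)) ((UT i).M (mseq i)))
    -- (iii)
    (hcM : ∀ i, ∀ x ∈ (US i).M (nseq i), c i x ∈ (UT i).M (mseq i))
    (hdM : ∀ i, ∀ x ∈ (UT i).M (mseq i), d i x ∈ (US (i + 1)).M (nseq (i + 1))) :
    ∃ f : SL ≃o TL, ∀ x y : SL, f (x + y) = f x + f y := by

  have H : Sys σ τ σinf τinf c d (fun i => (US i).M (nseq i)) (fun i => (UT i).M (mseq i)) :=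
    { hS := hS, hSL := hSL, hTL := hTL, σid := hσid, τid := hτid, σcomp := hσcomp, τcomp := hτcomp
      σcu := hσcu, τcu := hτcu, σinfcu := hσinfcu, τinfcu := hτinfcu, σinfcomp := hσinfcomp
      τinfcomp := hτinfcomp, L2S := hL2S, ccu := hc, dcu := hd
      hA := fun i j hij x hx => hMS i j hij x ((US i).M_mono (hn.monotone hij) hx)
      hB := fun i j hij x hx => hMT i j hij x ((UT i).M_mono (hm.monotone hij) hx)
      addA := fun i => (US i).add_mem _
      hdc := hdc, hcd := hcd, hcM := hcM, hdM := hdM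
      dense := dense_aux σ hσcomp hσcu σinf hσinfcu hσinfcomp hL1S US nseq hn hMS }
  have H' : Sys τ (fun i j => σ (i + 1) (j + 1)) τinf (fun i => σinf (i + 1)) d
      (fun i => c (i + 1)) (fun i => (UT i).M (mseq i)) (fun i => (US (i + 1)).M (nseq (i + 1))) :=
    { hS := hT, hSL := hTL, hTL := hSL, σid := hτid, τid := fun i => hσid (i + 1)
      σcomp := hτcomp
      τcomp := fun i j k h1 h2 => hσcomp _ _ _ (by omega) (by omega)
      σcu := hτcu, τcu := fun i j h => hσcu _ _ (by omega)
      σinfcu := hτinfcu, τinfcu := fun i => hσinfcu _, σinfcomp := hτinfcomp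
      τinfcomp := fun i j h => hσinfcomp _ _ (by omega)
      L2S := hL2T, ccu := hd, dcu := fun i => hc _
      hA := H.hB
      hB := fun i j h => H.hA _ _ (by omega)
      addA := fun i => (UT i).add_mem _
      hdc := hcd, hcd := fun i => hdc (i + 1), hcM := hdM, hdM := fun i => hcM (i + 1)
      dense := dense_aux τ hτcomp hτcu τinf hτinfcu hτinfcomp hL1T UT mseq hm hMT }
  -- the two relations
  let N : SL → TL → Prop := Nrel (fun i => (US i).M (nseq i)) σinf (fun i x => τinf i (c i x))
  let N' : TL → SL → Prop :=
    Nrel (fun i => (UT i).M (mseq i)) τinf (fun i y => σinf (i + 1) (d i y))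
  have shift : ∀ s t, N s t ↔ Nrel (fun i => (US (i + 1)).M (nseq (i + 1)))
      (fun i => σinf (i + 1)) (fun i x => τinf (i + 1) (c (i + 1) x)) s t := by
    intro s t
    constructor
    · rintro ⟨K, hK⟩
      exact ⟨K, fun i hi a ha has => hK (i + 1) (by omega) a ha has⟩
    · rintro ⟨K, hK⟩
      refine ⟨K + 1, fun i hi => ?_⟩
      obtain ⟨l, rfl⟩ : ∃ l, i = l + 1 := ⟨i - 1, by omega⟩
      exact fun a ha has => hK l (by omega) a ha has
  have exS : ∀ s, ∃ t, N s t ∧ N' t s := H.exist H'.fact4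
  have exT : ∀ t, ∃ s, N' t s ∧ N s t := by
    intro t
    obtain ⟨s, h1, h2⟩ := H'.exist (fun i j a b ha hb h => H.fact4 (i + 1) (j + 1) a b ha hb h) t
    exact ⟨s, h1, (shift _ _).2 h2⟩
  have compS : ∀ {s t s'}, N s t → N' t s' → s ≤ s' := fun h1 h2 => H.comp h1 h2
  have compT : ∀ {t s t'}, N' t s → N s t' → t ≤ t' :=
    fun h1 h2 => H'.comp h1 ((shift _ _).1 h2)
  have Nmono : ∀ {s1 s2 t1 t2}, s1 ≤ s2 → t1 ≤ t2 → N s2 t1 → N s1 t2 := by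
    rintro s1 s2 t1 t2 hs ht ⟨K, hK⟩
    exact ⟨K, fun i hi a ha has => (hK i hi a ha (has.trans hs)).trans ht⟩
  choose f hf hf' using exS
  have fle : ∀ {a b}, f a ≤ f b ↔ a ≤ b := by
    intro a b
    exact ⟨fun h => compS (Nmono le_rfl h (hf a)) (hf' b),
      fun h => compT (hf' a) (Nmono h le_rfl (hf b))⟩
  have fsurj : Function.Surjective f := by
    intro t
    obtain ⟨s, h1, h2⟩ := exT t
    exact ⟨s, le_antisymm (compT (hf' s) h2) (compT h1 (hf s))⟩
  refine ⟨(OrderEmbedding.ofMapLEIff f (fun a b => fle)).orderIso.trans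
    ((OrderIso.setCongr _ _ (by simpa using fsurj.range_eq)).trans OrderIso.Set.univ), ?_⟩
  intro x y
  show f (x + y) = f x + f y
  exact le_antisymm (compT (hf' _) (H.add (hf x) (hf y)))
    (compT (H'.add (hf' x) (hf' y)) (hf _))
end

section
/- Let S be a Cu-semigroup with a uniform basis (M_n, ε_n)_n. Then ∪_l M_l is dense in S: every element of S is the supremum of a ≪-increasing sequence of elements of ∪_l M_l. In particular, if every M_n is countable then S is countably based (it has a countable dense subset). -/
open Set

/-- The union of a uniform basis is dense; if all `M n` are countable, `S` is countably based. -/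
theorem uniformBasis_union_dense
    {S : Type*} [AddCommMonoid S] [PartialOrder S] [IsOrderedAddMonoid S] (hS : IsCu S) (U : UniformBasis S) :
    (∀ s : S, ∃ b : ℕ → S, (∀ k, b k ∈ ⋃ l, U.M l) ∧ (∀ k, WayBelow (b k) (b (k + 1))) ∧
      IsLUB (Set.range b) s) ∧
    ((∀ n, (U.M n).Countable) → ∃ B : Set S, B.Countable ∧
      ∀ s : S, ∃ b : ℕ → S, (∀ k, b k ∈ B) ∧ (∀ k, WayBelow (b k) (b (k + 1))) ∧
        IsLUB (Set.range b) s) := by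
  have key : ∀ s : S, ∃ b : ℕ → S, (∀ k, b k ∈ ⋃ l, U.M l) ∧
      (∀ k, WayBelow (b k) (b (k + 1))) ∧ IsLUB (Set.range b) s := by
    intro s
    obtain ⟨z, hz, hs⟩ := hS.O2 s
    have hw : ∀ n, z n ∈ wbSet S := fun n => ⟨_, hz n⟩
    have hm : ∀ n, ∃ m, z n ≤ U.eps m (z (n + 1)) := fun n =>
      hz n (fun m => U.eps m (z (n + 1))) (monotone_nat_of_le_succ (U.U3_mono _ (hw _)))
        _ (U.U3_sup _ (hw _)) le_rfl
    choose m hm using hm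
    have hb : ∀ n, WayBelow (U.eps (m n) (z (n + 1))) (z (n + 1)) :=
      fun n => U.U3_wb _ (hw _) _
    have hle : ∀ n, U.eps (m n) (z (n + 1)) ≤ z (n + 1) := fun n =>
      (U.U3_sup _ (hw (n + 1))).1 ⟨m n, rfl⟩
    refine ⟨fun n => U.eps (m n) (z (n + 1)), fun k => ?_, fun k => ?_, ?_, ?_⟩
    · exact Set.mem_iUnion.2 ⟨m k, U.eps_mem _ _ (hw _)⟩
    · intro y hy w hyw hle'
      exact hb k y hy w hyw ((hm (k + 1)).trans hle')
    · rintro _ ⟨n, rfl⟩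
      exact (hle n).trans (hs.1 ⟨n + 1, rfl⟩)
    · intro u hu
      apply hs.2
      rintro _ ⟨n, rfl⟩
      exact (hm n).trans (hu ⟨n, rfl⟩)
  exact ⟨key, fun hc => ⟨⋃ l, U.M l, Set.countable_iUnion hc, key⟩⟩
end

section
/- Let S and T be Cu-semigroups each admitting a uniform basis. Then the direct sum S ⊕ T (the product monoid with componentwise addition and componentwise order) is a Cu-semigroup admitting a uniform basis. -/
open Set

theorem lubRange_prod {S T : Type*} [Preorder S] [Preorder T] (z : ℕ → S × T) (w : S × T) :
    IsLUB (Set.range z) w ↔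
      IsLUB (Set.range fun n => (z n).1) w.1 ∧ IsLUB (Set.range fun n => (z n).2) w.2 := by
  rw [isLUB_prod, ← Set.range_comp, ← Set.range_comp]
  rfl

theorem lubRange_const {S : Type*} [Preorder S] (a : S) : IsLUB (Set.range fun _ : ℕ => a) a := by
  rw [Set.range_const]
  exact isLUB_singleton

theorem wayBelow_prod {S T : Type*} [Preorder S] [Preorder T] (x y : S × T) :
    WayBelow x y ↔ WayBelow x.1 y.1 ∧ WayBelow x.2 y.2 := by
  constructor
  · intro h
    constructor
    · intro z hz w hw hy
      obtain ⟨k, hk⟩ := h (fun n => (z n, y.2)) (fun a b hab => ⟨hz hab, le_rfl⟩) (w, y.2)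
        ((lubRange_prod _ _).2 ⟨hw, lubRange_const _⟩) ⟨hy, le_rfl⟩
      exact ⟨k, hk.1⟩
    · intro z hz w hw hy
      obtain ⟨k, hk⟩ := h (fun n => (y.1, z n)) (fun a b hab => ⟨le_rfl, hz hab⟩) (y.1, w)
        ((lubRange_prod _ _).2 ⟨lubRange_const _, hw⟩) ⟨le_rfl, hy⟩
      exact ⟨k, hk.2⟩
  · rintro ⟨h1, h2⟩ z hz w hw hy
    obtain ⟨hw1, hw2⟩ := (lubRange_prod _ _).1 hw
    obtain ⟨k, hk⟩ := h1 _ (fun a b hab => (hz hab).1) _ hw1 hy.1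
    obtain ⟨m, hm⟩ := h2 _ (fun a b hab => (hz hab).2) _ hw2 hy.2
    exact ⟨max k m, hk.trans (hz (le_max_left k m)).1, hm.trans (hz (le_max_right k m)).2⟩

theorem mem_wbSet_prod {S T : Type*} [Preorder S] [Preorder T] (x : S × T) :
    x ∈ wbSet (S × T) ↔ x.1 ∈ wbSet S ∧ x.2 ∈ wbSet T := by
  constructor
  · rintro ⟨t, ht⟩
    exact ⟨⟨_, ((wayBelow_prod _ _).1 ht).1⟩, ⟨_, ((wayBelow_prod _ _).1 ht).2⟩⟩
  · rintro ⟨⟨a, ha⟩, ⟨b, hb⟩⟩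
    exact ⟨(a, b), (wayBelow_prod _ _).2 ⟨ha, hb⟩⟩

/-- The direct sum of two uniformly based Cu-semigroups is a uniformly based Cu-semigroup. -/
theorem prod_uniformly_based
    {S T : Type*} [AddCommMonoid S] [PartialOrder S] [IsOrderedAddMonoid S] [AddCommMonoid T] [PartialOrder T] [IsOrderedAddMonoid T]
    (hS : IsCu S) (hT : IsCu T)
    (US : UniformBasis S) (UT : UniformBasis T) :
    IsCu (S × T) ∧ Nonempty (UniformBasis (S × T)) := by
  refine ⟨⟨?_, ?_, ?_, ?_, ?_⟩, ⟨{
    M := fun n => {x | x.1 ∈ US.M n ∧ x.2 ∈ UT.M n}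
    eps := fun n x => (US.eps n x.1, UT.eps n x.2)
    M_zero := ?_
    zero_mem := fun n => ⟨US.zero_mem n, UT.zero_mem n⟩
    add_mem := fun n x hx y hy =>
      ⟨US.add_mem n _ hx.1 _ hy.1, UT.add_mem n _ hx.2 _ hy.2⟩
    M_subset := fun n x hx =>
      (mem_wbSet_prod x).2 ⟨US.M_subset n hx.1, UT.M_subset n hx.2⟩
    eps_mem := fun n s hs => by
      rw [mem_wbSet_prod] at hs
      exact ⟨US.eps_mem n _ hs.1, UT.eps_mem n _ hs.2⟩
    eps_mono := fun n s hs t ht h => by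
      rw [mem_wbSet_prod] at hs ht
      exact ⟨US.eps_mono n _ hs.1 _ ht.1 h.1, UT.eps_mono n _ hs.2 _ ht.2 h.2⟩
    eps_superadd := fun n s hs t ht => by
      rw [mem_wbSet_prod] at hs ht
      exact ⟨US.eps_superadd n _ hs.1 _ ht.1, UT.eps_superadd n _ hs.2 _ ht.2⟩
    U1 := fun n x hx => ⟨US.U1 n hx.1, UT.U1 n hx.2⟩
    U2 := ?_
    U3_mono := fun s hs n => by
      rw [mem_wbSet_prod] at hs
      exact ⟨US.U3_mono _ hs.1 n, UT.U3_mono _ hs.2 n⟩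
    U3_wb := fun s hs n => by
      rw [mem_wbSet_prod] at hs
      exact (wayBelow_prod _ _).2 ⟨US.U3_wb _ hs.1 n, UT.U3_wb _ hs.2 n⟩
    U3_sup := fun s hs => by
      rw [mem_wbSet_prod] at hs
      exact (lubRange_prod _ _).2 ⟨US.U3_sup _ hs.1, UT.U3_sup _ hs.2⟩
    U4 := fun l s hs n hn =>
      (wayBelow_prod _ _).2 ⟨US.U4 l _ hs.1 n hn, UT.U4 l _ hs.2 n hn⟩ }⟩⟩
  · exact fun x => ⟨hS.zero_le _, hT.zero_le _⟩
  · intro z hz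
    obtain ⟨a, ha⟩ := hS.O1 (fun n => (z n).1) (fun i j h => (hz h).1)
    obtain ⟨b, hb⟩ := hT.O1 (fun n => (z n).2) (fun i j h => (hz h).2)
    exact ⟨(a, b), (lubRange_prod _ _).2 ⟨ha, hb⟩⟩
  · intro x
    obtain ⟨a, ha, ha'⟩ := hS.O2 x.1
    obtain ⟨b, hb, hb'⟩ := hT.O2 x.2
    exact ⟨fun n => (a n, b n), fun n => (wayBelow_prod _ _).2 ⟨ha n, hb n⟩,
      (lubRange_prod _ _).2 ⟨ha', hb'⟩⟩
  · intro x' x y' y hx hy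
    rw [wayBelow_prod] at *
    exact ⟨hS.O3 _ _ _ _ hx.1 hy.1, hT.O3 _ _ _ _ hx.2 hy.2⟩
  · intro x y hx hy a b ha hb
    rw [lubRange_prod] at *
    exact ⟨hS.O4 _ _ (fun i j h => (hx h).1) (fun i j h => (hy h).1) _ _ ha.1 hb.1,
      hT.O4 _ _ (fun i j h => (hx h).2) (fun i j h => (hy h).2) _ _ ha.2 hb.2⟩
  · ext x
    simp [US.M_zero, UT.M_zero, Prod.ext_iff]
  · rintro n s t ⟨l, hl, hs⟩ ⟨m, hm, ht⟩
    exact Prod.ext (US.U2 n _ _ ⟨l, hl, hs.1⟩ ⟨m, hm, ht.1⟩)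
      (UT.U2 n _ _ ⟨l, hl, hs.2⟩ ⟨m, hm, ht.2⟩)
end

section
/- For every r ∈ ℕ, the simplicial Cu-semigroup ℕ̄^r (finite sequences with entries in ℕ̄ = ℕ ∪ {∞}, with componentwise addition and componentwise order) admits a uniform basis. -/
open Set

theorem wb_fin {r : ℕ} {s t : Fin r → ℕ∞} (h : WayBelow s t) (i : Fin r) : s i ≠ ⊤ := by
  obtain ⟨k, hk⟩ := h (fun n _ => (n : ℕ∞)) (fun a b hab _ => by simpa using hab) (fun _ => ⊤) (by
    refine ⟨fun _ _ _ => le_top, fun b hb i => ?_⟩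
    have : ∀ n : ℕ, (n : ℕ∞) ≤ b i := fun n => hb ⟨n, rfl⟩ i
    exact (ENat.eq_top_iff_forall_ge.2 this).ge) (fun _ => le_top)
  exact ne_top_of_le_ne_top (ENat.natCast_ne_top k) (hk i)

theorem fin_wb {r : ℕ} {s : Fin r → ℕ∞} (h : ∀ i, s i ≠ ⊤) : WayBelow s s := by
  intro z hz w hw hsw
  have key : ∀ i, ∃ k, s i ≤ z k i := by
    intro i
    by_contra! hc
    have h1 := isLUB_pi.1 hw i
    obtain ⟨m, hm⟩ := ENat.ne_top_iff_exists.1 (h i)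
    have hm0 : m ≠ 0 := by
      rintro rfl
      have := hc 0
      simp [← hm] at this
    obtain ⟨p, rfl⟩ := Nat.exists_eq_succ_of_ne_zero hm0
    have h2 : w i ≤ (p : ℕ∞) := by
      apply h1.2
      rintro _ ⟨_, ⟨k, rfl⟩, rfl⟩
      have h3 := hc k
      rw [← hm] at h3
      show z k i ≤ p
      exact Order.le_of_lt_add_one (by simpa using h3)
    have h4 := (hsw i).trans h2
    rw [← hm] at h4
    have : p.succ ≤ p := ENat.coe_le_coe.1 h4
    omega
  choose f hf using key
  exact ⟨Finset.univ.sup f, fun i => (hf i).trans (hz (Finset.le_sup (Finset.mem_univ i)) i)⟩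

theorem mem_wb {r : ℕ} {s : Fin r → ℕ∞} : s ∈ wbSet (Fin r → ℕ∞) ↔ ∀ i, s i ≠ ⊤ :=
  ⟨fun ⟨_, h⟩ => wb_fin h, fun h => ⟨s, fin_wb h⟩⟩

theorem zero_wb {r : ℕ} (s : Fin r → ℕ∞) : WayBelow 0 s :=
  fun _ _ _ _ _ => ⟨0, fun _ => bot_le⟩

/-- Every simplicial Cu-semigroup `ℕ̄^r` admits a uniform basis. -/
theorem simplicial_uniformly_based (r : ℕ) :
    Nonempty (UniformBasis (Fin r → ℕ∞)) := by
  refine ⟨{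
    M := fun n => if n = 0 then {0} else wbSet _
    eps := fun n s => if n = 0 then 0 else s
    M_zero := by simp
    zero_mem := ?_
    add_mem := ?_
    M_subset := ?_
    eps_mem := ?_
    eps_mono := ?_
    eps_superadd := ?_
    U1 := ?_
    U2 := ?_
    U3_mono := ?_
    U3_wb := ?_
    U3_sup := ?_
    U4 := ?_ }⟩
  · intro n
    split_ifs
    · rfl
    · exact ⟨0, zero_wb 0⟩
  · intro n x hx y hy
    split_ifs at *
    · rw [mem_singleton_iff] at *
      simp [hx, hy]
    · rw [mem_wb] at *
      intro i
      simp [hx i, hy i]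
  · intro n x hx
    split_ifs at hx
    · rw [mem_singleton_iff.1 hx]
      exact ⟨0, zero_wb 0⟩
    · exact hx
  · intro n s hs
    split_ifs
    · rfl
    · exact hs
  · intro n s _ t _ h
    split_ifs
    · exact le_rfl
    · exact h
  · intro n s _ t _
    split_ifs
    · simp
    · exact le_rfl
  · intro n x hx
    rw [if_neg (Nat.succ_ne_zero n)]
    split_ifs at hx
    · rw [mem_singleton_iff.1 hx]
      exact ⟨0, zero_wb 0⟩
    · exact hx
  · intro n s t _ _
    split_ifs <;> simp
  · intro s _ n
    rw [if_neg (Nat.succ_ne_zero n)]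
    split_ifs
    · exact fun _ => bot_le
    · exact le_rfl
  · intro s hs n
    split_ifs
    · exact zero_wb s
    · exact fin_wb (mem_wb.1 hs)
  · intro s _
    refine ⟨?_, fun b hb => by simpa using hb ⟨1, rfl⟩⟩
    rintro _ ⟨n, rfl⟩
    dsimp only
    split_ifs
    · exact fun _ => bot_le
    · exact le_rfl
  · intro l s hs n hn
    rw [if_neg (Nat.succ_ne_zero n), if_neg (by omega)]
    split_ifs at hs
    · rw [mem_singleton_iff.1 hs]
      exact zero_wb 0
    · exact fin_wb (mem_wb.1 hs)
end

section
/- Let S be a Cu-semigroup with a chain-generating set Λ ⊆ S_≪. Then: (i) Λ is order-hereditary (if s ∈ S, λ ∈ Λ and s ≤ λ, then s ∈ Λ) and upward-directed (for λ₁, λ₂ ∈ Λ there is μ ∈ Λ with λ₁ ≤ μ and λ₂ ≤ μ); (ii) if s ∈ S_≪ and (s_n)_n is the chain-decomposition of s, then s_n = 0 for all but finitely many n. -/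
open Set

/-- `(s_n)` is a chain-decomposition of `x` relative to `Λ`. -/
def IsChainDecompOf {S : Type*} [AddCommMonoid S] [PartialOrder S] [IsOrderedAddMonoid S] (Λ : Set S) (s : ℕ → S) (x : S) : Prop :=
  (∀ n, s n ∈ Λ) ∧ Antitone s ∧
    IsLUB (Set.range fun k => ∑ n ∈ Finset.range k, s n) x

/-- `Λ` is a chain-generating set of `S`. -/
def IsChainGen {S : Type*} [AddCommMonoid S] [PartialOrder S] [IsOrderedAddMonoid S] (Λ : Set S) : Prop :=
  Λ ⊆ wbSet S ∧
  (∀ s t : ℕ → S, (∀ n, s n ∈ Λ) → (∀ n, t n ∈ Λ) → Antitone s → Antitone t →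
    ∀ a b : S, IsLUB (Set.range fun k => ∑ n ∈ Finset.range k, s n) a →
      IsLUB (Set.range fun k => ∑ n ∈ Finset.range k, t n) b →
      (a ≤ b ↔ ∀ n, s n ≤ t n)) ∧
  (∀ x : S, ∃ s : ℕ → S, IsChainDecompOf Λ s x)

/-- Truncating a decreasing sequence of `Λ` decomposes the partial sum. -/
theorem isChainDecompOf_trunc
    {S : Type*} [AddCommMonoid S] [PartialOrder S] [IsOrderedAddMonoid S] (hS : IsCu S)
    (Λ : Set S) (h0 : (0 : S) ∈ Λ) (t : ℕ → S) (ht : ∀ n, t n ∈ Λ) (hanti : Antitone t) (k : ℕ) :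
    IsChainDecompOf Λ (fun n => if n < k then t n else 0) (∑ n ∈ Finset.range k, t n) := by
  have key : ∀ m, ∑ n ∈ Finset.range m, (if n < k then t n else 0)
      = ∑ n ∈ Finset.range (min m k), t n := by
    intro m
    induction m with
    | zero => simp
    | succ m ih =>
      rw [Finset.sum_range_succ, ih]
      by_cases h : m < k
      · rw [if_pos h, min_eq_left h.le, min_eq_left (by omega), Finset.sum_range_succ]
      · rw [if_neg h, min_eq_right (by omega), min_eq_right (by omega), add_zero]
  refine ⟨?_, ?_, ?_⟩
  · intro n
    dsimp only
    split_ifs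
    · exact ht n
    · exact h0
  · intro a b hab
    dsimp only
    split_ifs with h1 h2
    · exact hanti hab
    · omega
    · exact hS.zero_le _
    · exact le_rfl
  · apply IsGreatest.isLUB
    refine ⟨⟨k, by simp only [key, min_self]⟩, ?_⟩
    rintro _ ⟨m, rfl⟩
    simp only [key]
    apply Finset.sum_le_sum_of_subset_of_nonneg
    · exact Finset.range_mono (min_le_right _ _)
    · intro i _ _
      exact hS.zero_le _

/-- Properties of chain-generating sets: order-hereditary, upward-directed, and finiteness of
chain-decompositions of elements of `S_≪`. -/
theorem chainGen_properties
    {S : Type*} [AddCommMonoid S] [PartialOrder S] [IsOrderedAddMonoid S] (hS : IsCu S)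
    (Λ : Set S) (hΛ : IsChainGen Λ) :
    (∀ s : S, ∀ l ∈ Λ, s ≤ l → s ∈ Λ) ∧
    (∀ l₁ ∈ Λ, ∀ l₂ ∈ Λ, ∃ μ ∈ Λ, l₁ ≤ μ ∧ l₂ ≤ μ) ∧
    (∀ x ∈ wbSet S, ∀ s : ℕ → S, IsChainDecompOf Λ s x → ∃ N, ∀ n ≥ N, s n = 0) := by
  obtain ⟨hwb, hcmp, hdec⟩ := hΛ
  have hle0 : ∀ x : S, x ≤ 0 → x = 0 := fun x hx => le_antisymm hx (hS.zero_le x)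
  have hsumle : ∀ (s : ℕ → S) (x : S), IsChainDecompOf Λ s x → s 0 ≤ x := by
    intro s x h
    have := h.2.2.1 ⟨1, rfl⟩
    simpa using this
  have h0 : (0 : S) ∈ Λ := by
    obtain ⟨s, hs⟩ := hdec 0
    rw [← hle0 _ (hsumle s 0 hs)]
    exact hs.1 0
  have hone : ∀ l ∈ Λ, IsChainDecompOf Λ (fun n => if n < 1 then l else 0) l := by
    intro l hl
    have := isChainDecompOf_trunc hS Λ h0 (fun _ => l) (fun _ => hl) (fun _ _ _ => le_rfl) 1
    simpa using this
  have hcomp : ∀ (s t : ℕ → S) (a b : S), IsChainDecompOf Λ s a → IsChainDecompOf Λ t b →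
      a ≤ b → ∀ n, s n ≤ t n := by
    intro s t a b hs ht hab
    exact (hcmp s t hs.1 ht.1 hs.2.1 ht.2.1 a b hs.2.2 ht.2.2).1 hab
  refine ⟨?_, ?_, ?_⟩
  · intro x l hl hxl
    obtain ⟨s, hs⟩ := hdec x
    have h1 := hcomp _ _ _ _ hs (hone l hl) hxl
    have hx : x = s 0 := by
      apply le_antisymm _ (hsumle s x hs)
      apply hs.2.2.2
      rintro _ ⟨m, rfl⟩
      cases m with
      | zero => simpa using hS.zero_le _
      | succ m =>
        have hz : ∀ i, s (i + 1) = 0 := by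
          intro i
          apply hle0
          simpa using h1 (i + 1)
        simp [Finset.sum_range_succ', hz]
    rw [hx]
    exact hs.1 0
  · intro a ha b hb
    obtain ⟨t, ht⟩ := hdec (a + b)
    refine ⟨t 0, ht.1 0, ?_, ?_⟩
    · have := hcomp _ _ _ _ (hone a ha) ht (le_add_of_nonneg_right (hS.zero_le b)) 0
      simpa using this
    · have := hcomp _ _ _ _ (hone b hb) ht (le_add_of_nonneg_left (hS.zero_le a)) 0
      simpa using this
  · rintro x ⟨y, hxy⟩ s hs
    obtain ⟨t, ht⟩ := hdec y
    obtain ⟨k, hk⟩ := hxy (fun k => ∑ n ∈ Finset.range k, t n) (by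
      intro a b hab
      apply Finset.sum_le_sum_of_subset_of_nonneg (Finset.range_mono hab)
      intro i _ _
      exact hS.zero_le _) y ht.2.2 le_rfl
    refine ⟨k, fun n hn => hle0 _ ?_⟩
    have := hcomp _ _ _ _ hs (isChainDecompOf_trunc hS Λ h0 t ht.1 ht.2.1 k) hk n
    simpa [not_lt.2 hn] using this
end
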